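/- Let n > 1, k ≥ 3, and let g_1, …, g_n ∈ C_0^k(M^n, 𝔸) have compact support. Then the condition that g_j(x) = −∂̄_j ( ∫_M E(y_1) g_1(y_1 + x_1, x^0) dV(y_1) ) for all j = 2, …, n and all x = (x_1, x^0) ∈ M^n is equivalent to the condition that ∫_M ∑_{s=0}^m v_s ( E(y_1) ( (∂g_j/∂x_{1,s} − ∂g_1/∂x_{j,s})(y_1 + x_1, x^0) ) ) dV(y_1) = 0 for all j = 2, …, n and all x = (x_1, x^0) ∈ M^n. -/

import Mathlib

open MeasureTheory

noncomputable section

/-- A real alternative `*`-algebra of finite dimension `> 1`, with a fixed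
hypercomplex basis `v 0 = 1, v 1, …, v m` spanning the hypercomplex subspace `M`.
Multiplication is `ℝ`-bilinear (bundled as a linear map). -/
structure HCAlg (𝔸 : Type) [NormedAddCommGroup 𝔸] [NormedSpace ℝ 𝔸] (m : ℕ) : Type where
  mul : 𝔸 →ₗ[ℝ] 𝔸 →ₗ[ℝ] 𝔸
  one : 𝔸
  conj : 𝔸 →ₗ[ℝ] 𝔸
  findim : FiniteDimensional ℝ 𝔸
  dim_gt_one : 1 < Module.finrank ℝ 𝔸
  one_mul' : ∀ a, mul one a = a
  mul_one' : ∀ a, mul a one = a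
  alt_left : ∀ a b, mul a (mul a b) = mul (mul a a) b
  alt_right : ∀ a b, mul (mul b a) a = mul b (mul a a)
  conj_invol : ∀ a, conj (conj a) = a
  conj_mul' : ∀ a b, conj (mul a b) = mul (conj b) (conj a)
  conj_one : conj one = one
  hm : 1 ≤ m
  v : Fin (m + 1) → 𝔸
  v_indep : LinearIndependent ℝ v
  v_zero : v 0 = one
  v_trace : ∀ s, s ≠ 0 → v s + conj (v s) = 0
  v_norm : ∀ s, s ≠ 0 → mul (v s) (conj (v s)) = one
  v_anticomm : ∀ s t, s ≠ 0 → t ≠ 0 → s ≠ t → mul (v s) (v t) = -(mul (v t) (v s))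

variable {𝔸 : Type} [NormedAddCommGroup 𝔸] [NormedSpace ℝ 𝔸] {m n : ℕ}

/-- `M^n`, identified with `ℝ^{(m+1)n}` via the coordinates `x j s`. -/
abbrev Mn (n m : ℕ) := Fin n → Fin (m + 1) → ℝ

/-- Euclidean norm of a point of `M` (in coordinates). -/
def enormM (c : Fin (m + 1) → ℝ) : ℝ := Real.sqrt (∑ s, c s ^ 2)

/-- Euclidean norm of a point of `M^n` (in coordinates). -/
def enormMn (x : Mn n m) : ℝ := Real.sqrt (∑ j, ∑ s, x j s ^ 2)

/-- Partial derivative `∂f/∂x_{j,s}` for functions on `M^n`. -/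
def pd {E : Type} [NormedAddCommGroup E] [NormedSpace ℝ E]
    (f : Mn n m → E) (j : Fin n) (s : Fin (m + 1)) (x : Mn n m) : E :=
  fderiv ℝ f x (Pi.single j (Pi.single s 1))

/-- Partial derivative `∂f/∂x_s` for functions on `M`. -/
def pd1 {E : Type} [NormedAddCommGroup E] [NormedSpace ℝ E]
    (f : (Fin (m + 1) → ℝ) → E) (s : Fin (m + 1)) (x : Fin (m + 1) → ℝ) : E :=
  fderiv ℝ f x (Pi.single s 1)

/-- The Dirac (Cauchy–Riemann) operator `∂̄_j = ∑_s v_s ∂/∂x_{j,s}`. -/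
def dbar (H : HCAlg 𝔸 m) (f : Mn n m → 𝔸) (j : Fin n) (x : Mn n m) : 𝔸 :=
  ∑ s, H.mul (H.v s) (pd f j s x)

/-- The conjugated Dirac operator `∂_j = ∑_s v_s^c ∂/∂x_{j,s}`. -/
def dconj (H : HCAlg 𝔸 m) (f : Mn n m → 𝔸) (j : Fin n) (x : Mn n m) : 𝔸 :=
  ∑ s, H.mul (H.conj (H.v s)) (pd f j s x)

/-- The Laplacian `Δ_j = ∑_s ∂²/∂x_{j,s}²` in the `j`-th block of variables. -/
def lap {E : Type} [NormedAddCommGroup E] [NormedSpace ℝ E]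
    (f : Mn n m → E) (j : Fin n) (x : Mn n m) : E :=
  ∑ s, pd (pd f j s) j s x

/-- Surface area of the unit `(N-1)`-sphere in `ℝ^N`: `σ_N = 2 π^{N/2} / Γ(N/2)`. -/
def usigma (N : ℕ) : ℝ := 2 * Real.pi ^ ((N : ℝ) / 2) / Real.Gamma ((N : ℝ) / 2)

/-- Embedding of coordinates into the hypercomplex subspace `M ⊆ 𝔸`. -/
def embM (H : HCAlg 𝔸 m) (c : Fin (m + 1) → ℝ) : 𝔸 := ∑ s, c s • H.v s

/-- The Cauchy kernel `E(x) = σ_{m+1}⁻¹ x^c / |x|^{m+1}` on `M`. -/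
def CauchyE (H : HCAlg 𝔸 m) (c : Fin (m + 1) → ℝ) : 𝔸 :=
  (usigma (m + 1) * enormM c ^ (m + 1))⁻¹ • H.conj (embM H c)

/-- The Bochner–Martinelli kernel components `K_j(x) = σ_N⁻¹ x_j^c / |x|^N`, `N = (m+1)n`. -/
def Kker (H : HCAlg 𝔸 m) (n : ℕ) (j : Fin n) (x : Mn n m) : 𝔸 :=
  (usigma ((m + 1) * n) * enormMn x ^ ((m + 1) * n))⁻¹ • H.conj (embM H (x j))

/-- `Tsol g (x) = −∫_M E(y₁ − x₁) (g(y₁, x⁰)) dV(y₁)`. -/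
def Tsol (H : HCAlg 𝔸 m) (hn : 0 < n) (g : Mn n m → 𝔸) (x : Mn n m) : 𝔸 :=
  - ∫ y1 : Fin (m + 1) → ℝ,
      H.mul (CauchyE H (y1 - x ⟨0, hn⟩)) (g (Function.update x ⟨0, hn⟩ y1))

/-- `Fint g (x) = ∫_M E(y₁) (g(y₁ + x₁, x⁰)) dV(y₁)`. -/
def Fint (H : HCAlg 𝔸 m) (hn : 0 < n) (g : Mn n m → 𝔸) (x : Mn n m) : 𝔸 :=
  ∫ y1 : Fin (m + 1) → ℝ,
      H.mul (CauchyE H y1) (g (Function.update x ⟨0, hn⟩ (y1 + x ⟨0, hn⟩)))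



open Set Filter Topology Metric

namespace HCAlg

theorem conj_v (H : HCAlg 𝔸 m) {s : Fin (m + 1)} (hs : s ≠ 0) : H.conj (H.v s) = -H.v s :=
  (neg_eq_of_add_eq_zero_right (H.v_trace s hs)).symm

theorem conj_v_zero (H : HCAlg 𝔸 m) : H.conj (H.v 0) = H.one := by
  rw [H.v_zero, H.conj_one]

/-- Linearization of left alternativity. -/
theorem mul_mul_add_mul_mul (H : HCAlg 𝔸 m) (a b c : 𝔸) :
    H.mul a (H.mul b c) + H.mul b (H.mul a c) = H.mul (H.mul a b + H.mul b a) c := by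
  have h := H.alt_left (a + b) c
  have ha := H.alt_left a c
  have hb := H.alt_left b c
  simp only [map_add, LinearMap.add_apply] at h ⊢
  rw [ha, hb] at h
  have h' := sub_eq_zero.2 h
  rw [← sub_eq_zero, ← h']
  abel

theorem mul_v_mul_conj_v_self (H : HCAlg 𝔸 m) (s : Fin (m + 1)) (a : 𝔸) :
    H.mul (H.v s) (H.mul (H.conj (H.v s)) a) = a := by
  by_cases hs : s = 0
  · subst hs
    rw [H.conj_v_zero, H.v_zero, H.one_mul', H.one_mul']
  · have h := H.v_norm s hs
    rw [H.conj_v hs] at h ⊢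
    simp only [map_neg, LinearMap.neg_apply] at h ⊢
    rw [H.alt_left, ← LinearMap.neg_apply, ← map_neg, h, H.one_mul']

theorem mul_v_mul_conj_v_symm (H : HCAlg 𝔸 m) {s t : Fin (m + 1)} (hst : s ≠ t) (a : 𝔸) :
    H.mul (H.v s) (H.mul (H.conj (H.v t)) a) + H.mul (H.v t) (H.mul (H.conj (H.v s)) a) = 0 := by
  by_cases hs : s = 0
  · subst hs
    rw [H.conj_v_zero, H.conj_v hst.symm, H.v_zero]
    simp [H.one_mul']
  · by_cases ht : t = 0
    · subst ht
      rw [H.conj_v_zero, H.conj_v hs, H.v_zero]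
      simp [H.one_mul']
    · rw [H.conj_v hs, H.conj_v ht]
      simp only [map_neg, LinearMap.neg_apply]
      rw [← neg_add, H.mul_mul_add_mul_mul, H.v_anticomm s t hs ht hst]
      simp

/-- Contracting a symmetric family with `v_s (v_t^c ·)` gives its trace. -/
theorem sum_mul_v_mul_conj_v (H : HCAlg 𝔸 m) (I : Fin (m + 1) → Fin (m + 1) → 𝔸)
    (hI : ∀ s t, I s t = I t s) :
    ∑ s, ∑ t, H.mul (H.v s) (H.mul (H.conj (H.v t)) (I t s)) = ∑ s, I s s := by
  set S := ∑ s, ∑ t, H.mul (H.v s) (H.mul (H.conj (H.v t)) (I t s)) with hS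
  have h2 : S + S = ∑ s, I s s + ∑ s, I s s := by
    conv_lhs => rw [hS]; arg 2; rw [Finset.sum_comm]
    rw [← Finset.sum_add_distrib, ← Finset.sum_add_distrib]
    refine Finset.sum_congr rfl fun s _ ↦ ?_
    rw [← Finset.sum_add_distrib, Finset.sum_eq_single s]
    · simp [H.mul_v_mul_conj_v_self]
    · intro t _ hts
      rw [hI s t]
      exact H.mul_v_mul_conj_v_symm hts.symm _
    · simp
  rw [← two_smul ℝ, ← two_smul ℝ] at h2
  exact smul_right_injective 𝔸 (two_ne_zero (α := ℝ)) h2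

end HCAlg

section Radial

variable {E F : Type*} [NormedAddCommGroup E] [NormedSpace ℝ E] [FiniteDimensional ℝ E]
  [Nontrivial E] [MeasurableSpace E] [BorelSpace E] (μ : Measure E) [μ.IsAddHaarMeasure]
  [NormedAddCommGroup F] [NormedSpace ℝ F]

theorem integrable_norm_pow_inv_smul_fderiv {φ : E → F} (hφ : ContDiff ℝ 1 φ)
    (hφs : HasCompactSupport φ) :
    Integrable (fun x ↦ (‖x‖ ^ Module.finrank ℝ E)⁻¹ • fderiv ℝ φ x x) μ := by
  have hd : 1 ≤ Module.finrank ℝ E := Module.finrank_pos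
  have hc : Continuous (fderiv ℝ φ) := hφ.continuous_fderiv one_ne_zero
  have hcs : HasCompactSupport (fderiv ℝ φ) := hφs.fderiv ℝ
  have hk : LocallyIntegrable (fun x : E ↦ (‖x‖ ^ (Module.finrank ℝ E - 1))⁻¹) μ := by
    refine locallyIntegrable_of_norm_le_rpow hd (C := 1)
      (α := ((Module.finrank ℝ E - 1 : ℕ) : ℝ)) ?_ (.of_forall fun x ↦ ?_) ?_
    · exact_mod_cast Nat.sub_lt hd one_pos
    · rw [Real.rpow_neg (norm_nonneg x), Real.rpow_natCast, one_mul, norm_inv, norm_pow, norm_norm]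
    · exact (by fun_prop : Measurable fun x : E ↦ (‖x‖ ^ (Module.finrank ℝ E - 1))⁻¹)
        |>.aestronglyMeasurable
  have hb := hk.integrable_smul_right_of_hasCompactSupport hc.norm hcs.norm
  refine hb.mono ?_ (.of_forall fun x ↦ ?_)
  · refine AEStronglyMeasurable.smul ?_ ?_
    · exact (by fun_prop : Measurable fun x : E ↦ (‖x‖ ^ Module.finrank ℝ E)⁻¹)
        |>.aestronglyMeasurable
    · exact (hc.clm_apply continuous_id).aestronglyMeasurable
  · rw [norm_smul, norm_smul, norm_inv, norm_inv, norm_pow, norm_pow, norm_norm, norm_norm]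
    rcases eq_or_ne x 0 with rfl | hx
    · simp only [map_zero, norm_zero, mul_zero]
      positivity
    · have hx' : 0 < ‖x‖ := norm_pos_iff.2 hx
      calc (‖x‖ ^ Module.finrank ℝ E)⁻¹ * ‖fderiv ℝ φ x x‖
          ≤ (‖x‖ ^ Module.finrank ℝ E)⁻¹ * (‖fderiv ℝ φ x‖ * ‖x‖) := by
            gcongr
            exact ContinuousLinearMap.le_opNorm _ _
        _ = (‖x‖ ^ (Module.finrank ℝ E - 1))⁻¹ * ‖fderiv ℝ φ x‖ := by
            obtain ⟨k, hk⟩ := Nat.exists_eq_add_of_le hd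
            rw [hk, Nat.add_sub_cancel_left, pow_add, pow_one]
            field_simp

theorem integral_Ioi_fderiv_ray {E F : Type*} [NormedAddCommGroup E] [NormedSpace ℝ E]
    [NormedAddCommGroup F] [NormedSpace ℝ F] [CompleteSpace F] {φ : E → F} (hφ : ContDiff ℝ 1 φ)
    (hφs : HasCompactSupport φ) {w : E} (hw : w ≠ 0) :
    ∫ r in Ioi (0 : ℝ), fderiv ℝ φ (r • w) w = -φ 0 := by
  have hc : Continuous (fderiv ℝ φ) := hφ.continuous_fderiv one_ne_zero
  have hcs : HasCompactSupport (fderiv ℝ φ) := hφs.fderiv ℝ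
  have hemb : IsClosedEmbedding fun r : ℝ ↦ r • w := isClosedEmbedding_smul_left hw
  have hderiv (r : ℝ) : HasDerivAt (fun r : ℝ ↦ φ (r • w)) (fderiv ℝ φ (r • w) w) r := by
    have h1 : HasDerivAt (fun r : ℝ ↦ r • w) w r := by
      simpa using (hasDerivAt_id r).smul_const w
    exact ((hφ.differentiable one_ne_zero (r • w)).hasFDerivAt).comp_hasDerivAt r h1
  have hint : Integrable fun r : ℝ ↦ fderiv ℝ φ (r • w) w := by
    refine Continuous.integrable_of_hasCompactSupport ?_ ?_
    · exact (hc.comp hemb.continuous).clm_apply continuous_const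
    · exact (hcs.comp_isClosedEmbedding hemb).comp_left
        (g := fun L : E →L[ℝ] F ↦ L w) (by simp)
  have hlim : Tendsto (fun r : ℝ ↦ φ (r • w)) atTop (𝓝 0) := by
    have := (hφs.comp_isClosedEmbedding hemb).is_zero_at_infty
    exact this.mono_left atTop_le_cocompact
  have := integral_Ioi_of_hasDerivAt_of_tendsto' (a := 0) (fun r _ ↦ hderiv r)
    hint.integrableOn hlim
  simpa using this

theorem integral_norm_pow_inv_smul_fderiv [CompleteSpace F] {φ : E → F} (hφ : ContDiff ℝ 1 φ)
    (hφs : HasCompactSupport φ) :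
    ∫ x, (‖x‖ ^ Module.finrank ℝ E)⁻¹ • fderiv ℝ φ x x ∂μ = -(μ.toSphere.real univ • φ 0) := by
  set G : E → F := fun x ↦ (‖x‖ ^ Module.finrank ℝ E)⁻¹ • fderiv ℝ φ x x with hG
  have hGi : Integrable G μ := integrable_norm_pow_inv_smul_fderiv μ hφ hφs
  have hd : 1 ≤ Module.finrank ℝ E := Module.finrank_pos
  have hmp := μ.measurePreserving_homeomorphUnitSphereProd
  have hme : MeasurableEmbedding (homeomorphUnitSphereProd E) := Homeomorph.measurableEmbedding _
  set Q : sphere (0 : E) 1 × Ioi (0 : ℝ) → F := fun p ↦ G (p.2.1 • p.1.1) with hQ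
  have hQG (x : ({0}ᶜ : Set E)) : Q (homeomorphUnitSphereProd E x) = G x := by
    have : ((homeomorphUnitSphereProd E).symm (homeomorphUnitSphereProd E x) : E) = x := by simp
    rw [homeomorphUnitSphereProd_symm_apply_coe] at this
    rw [hQ]
    exact congrArg G this
  have hQi : Integrable Q (μ.toSphere.prod (.volumeIoiPow (Module.finrank ℝ E - 1))) := by
    rw [← hmp.integrable_comp_emb hme]
    have : IntegrableOn G ({0}ᶜ : Set E) μ := hGi.integrableOn
    rw [integrableOn_iff_comap_subtypeVal (by measurability)] at this
    refine this.congr (.of_forall fun x ↦ ?_)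
    exact (hQG x).symm
  calc
    ∫ x, G x ∂μ = ∫ x : ({(0)}ᶜ : Set E), G x ∂(μ.comap (↑)) := by
      rw [integral_subtype_comap (measurableSet_singleton _).compl G,
        restrict_compl_singleton]
    _ = ∫ p, Q p ∂μ.toSphere.prod (.volumeIoiPow (Module.finrank ℝ E - 1)) := by
      rw [← hmp.integral_comp hme]
      simp only [hQG]
    _ = ∫ w : sphere (0 : E) 1, -φ 0 ∂μ.toSphere := by
      rw [integral_prod _ hQi]
      refine integral_congr_ae (.of_forall fun w ↦ ?_)
      have hw1 : ‖w.1‖ = 1 := by simp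
      have hw : w.1 ≠ 0 := by
        intro h
        simp [h] at hw1
      simp only [Measure.volumeIoiPow, ENNReal.ofReal]
      rw [integral_withDensity_eq_integral_smul, ← integral_Ioi_fderiv_ray hφ hφs hw,
        integral_subtype_comap measurableSet_Ioi
          fun a ↦ Real.toNNReal (a ^ (Module.finrank ℝ E - 1)) • G (a • w.1)]
      · refine setIntegral_congr_fun measurableSet_Ioi fun r (hr : 0 < r) ↦ ?_
        simp only [hG]
        rw [NNReal.smul_def, Real.coe_toNNReal _ (pow_nonneg hr.le _), norm_smul, hw1, mul_one,
          Real.norm_of_nonneg hr.le, map_smul, smul_smul, smul_smul]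
        have : r ^ (Module.finrank ℝ E - 1) * ((r ^ Module.finrank ℝ E)⁻¹ * r) = 1 := by
          obtain ⟨k, hk⟩ := Nat.exists_eq_add_of_le hd
          rw [hk, Nat.add_sub_cancel_left, pow_add, pow_one]
          field_simp
        rw [← mul_assoc] at this
        rw [this, one_smul]
      · exact (measurable_subtype_coe.pow_const _).real_toNNReal
    _ = _ := by simp

end Radial

section Kernel

variable {F : Type*} [NormedAddCommGroup F] [NormedSpace ℝ F]

theorem enormM_eq_norm (z : EuclideanSpace ℝ (Fin (m + 1))) : enormM (z.ofLp) = ‖z‖ := by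
  simp [enormM, EuclideanSpace.norm_eq]

theorem enormM_nonneg (x : Fin (m + 1) → ℝ) : 0 ≤ enormM x := Real.sqrt_nonneg _

theorem abs_apply_le_enormM (x : Fin (m + 1) → ℝ) (t : Fin (m + 1)) : |x t| ≤ enormM x :=
  Real.abs_le_sqrt (Finset.single_le_sum (f := fun s ↦ x s ^ 2) (fun _ _ ↦ sq_nonneg _)
    (Finset.mem_univ t))

theorem norm_le_enormM (x : Fin (m + 1) → ℝ) : ‖x‖ ≤ enormM x :=
  (pi_norm_le_iff_of_nonneg (enormM_nonneg x)).2 fun t ↦ abs_apply_le_enormM x t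

theorem continuous_enormM : Continuous (enormM : (Fin (m + 1) → ℝ) → ℝ) := by
  unfold enormM
  fun_prop

/-- The component `x_t / |x|^{m+1}` of the unnormalized Cauchy kernel. -/
def rieszKernel (t : Fin (m + 1)) (x : Fin (m + 1) → ℝ) : ℝ := (enormM x ^ (m + 1))⁻¹ * x t

theorem norm_rieszKernel_le (t : Fin (m + 1)) (x : Fin (m + 1) → ℝ) :
    ‖rieszKernel t x‖ ≤ (‖x‖ ^ m)⁻¹ := by
  rcases eq_or_ne x 0 with rfl | hx
  · simp only [rieszKernel, Pi.zero_apply, mul_zero, norm_zero]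
    positivity
  · have hx' : 0 < ‖x‖ := norm_pos_iff.2 hx
    have he : 0 < enormM x := hx'.trans_le (norm_le_enormM x)
    calc ‖rieszKernel t x‖ = (enormM x ^ (m + 1))⁻¹ * |x t| := by
          rw [rieszKernel, norm_mul, norm_inv, norm_pow, Real.norm_of_nonneg he.le, Real.norm_eq_abs]
      _ ≤ (enormM x ^ (m + 1))⁻¹ * enormM x := by
          gcongr
          exact abs_apply_le_enormM x t
      _ = (enormM x ^ m)⁻¹ := by
          rw [pow_succ]
          field_simp
      _ ≤ (‖x‖ ^ m)⁻¹ := by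
          gcongr
          exact norm_le_enormM x

theorem locallyIntegrable_rieszKernel (t : Fin (m + 1)) :
    LocallyIntegrable (rieszKernel t) := by
  refine locallyIntegrable_of_norm_le_rpow (C := 1) (α := (m : ℝ)) (by simp) (by simp)
    (.of_forall fun x ↦ ?_) ?_
  · rw [Real.rpow_neg (norm_nonneg x), Real.rpow_natCast, one_mul]
    exact norm_rieszKernel_le t x
  · have := (continuous_enormM (m := m)).measurable
    exact (by unfold rieszKernel; fun_prop : Measurable (rieszKernel t)).aestronglyMeasurable

theorem integrable_rieszKernel_smul (t : Fin (m + 1)) {f : (Fin (m + 1) → ℝ) → F}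
    (hf : Continuous f) (hfs : HasCompactSupport f) :
    Integrable fun x ↦ rieszKernel t x • f x :=
  (locallyIntegrable_rieszKernel t).integrable_smul_right_of_hasCompactSupport hf hfs

theorem usigma_eq_toSphere_real_univ :
    (volume : Measure (EuclideanSpace ℝ (Fin (m + 1)))).toSphere.real univ = usigma (m + 1) := by
  have hN : (0 : ℝ) < (m + 1 : ℕ) := by positivity
  have hG : 0 < Real.Gamma (((m + 1 : ℕ) : ℝ) / 2) := Real.Gamma_pos_of_pos (by positivity)
  rw [Measure.toSphere_real_apply_univ, Measure.real, EuclideanSpace.volume_ball,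
    finrank_euclideanSpace, Fintype.card_fin, ENNReal.ofReal_one, one_pow, one_mul,
    Real.Gamma_add_one (by positivity), ENNReal.toReal_ofReal (by positivity), usigma,
    Real.sqrt_eq_rpow, ← Real.rpow_natCast, ← Real.rpow_mul Real.pi_pos.le]
  rw [show (1 / 2 : ℝ) * ((m + 1 : ℕ) : ℝ) = ((m + 1 : ℕ) : ℝ) / 2 by ring]
  field_simp

theorem usigma_pos : 0 < usigma (m + 1) := by
  have hG : 0 < Real.Gamma (((m + 1 : ℕ) : ℝ) / 2) := Real.Gamma_pos_of_pos (by positivity)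
  unfold usigma
  positivity

theorem sum_integral_rieszKernel_smul_fderiv [CompleteSpace F] {φ : (Fin (m + 1) → ℝ) → F}
    (hφ : ContDiff ℝ 1 φ) (hφs : HasCompactSupport φ) :
    ∑ s, ∫ x, rieszKernel s x • fderiv ℝ φ x (Pi.single s 1) = -(usigma (m + 1) • φ 0) := by
  have hc : Continuous (fderiv ℝ φ) := hφ.continuous_fderiv one_ne_zero
  have hcs : HasCompactSupport (fderiv ℝ φ) := hφs.fderiv ℝ
  rw [← integral_finsetSum _ fun s _ ↦ integrable_rieszKernel_smul s
    (hc.clm_apply continuous_const)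
    (hcs.comp_left (g := fun L : (Fin (m + 1) → ℝ) →L[ℝ] F ↦ L (Pi.single s 1)) (by simp))]
  let e := PiLp.continuousLinearEquiv 2 ℝ (fun _ : Fin (m + 1) ↦ ℝ)
  have hψ : ContDiff ℝ 1 (φ ∘ e) := hφ.comp e.contDiff
  have hψs : HasCompactSupport (φ ∘ e) := hφs.comp_homeomorph e.toHomeomorph
  have h := integral_norm_pow_inv_smul_fderiv
    (volume : Measure (EuclideanSpace ℝ (Fin (m + 1)))) hψ hψs
  rw [usigma_eq_toSphere_real_univ, finrank_euclideanSpace, Fintype.card_fin] at h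
  rw [← (PiLp.volume_preserving_ofLp (Fin (m + 1))).integral_comp
    (MeasurableEquiv.toLp 2 (Fin (m + 1) → ℝ)).symm.measurableEmbedding]
  convert! h using 1
  · refine integral_congr_ae (.of_forall fun z ↦ ?_)
    have hd : fderiv ℝ (φ ∘ e) z z = fderiv ℝ φ z.ofLp z.ofLp := by
      rw [e.comp_right_fderiv]
      rfl
    simp only [rieszKernel, hd, enormM_eq_norm, mul_smul, ← Finset.smul_sum]
    congr 1
    conv_rhs => arg 2; rw [pi_eq_sum_univ' z.ofLp]
    rw [map_sum]
    refine Finset.sum_congr rfl fun s _ ↦ ?_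
    rw [map_smul]

/-- A smooth regularization of `rieszKernel`. -/
def regKernel (ε : ℝ) (t : Fin (m + 1)) (x : Fin (m + 1) → ℝ) : ℝ :=
  (√(∑ s, x s ^ 2 + ε) ^ (m + 1))⁻¹ * x t

theorem contDiff_regKernel {ε : ℝ} (hε : 0 < ε) (t : Fin (m + 1)) :
    ContDiff ℝ 1 (regKernel ε t) := by
  have hpos (x : Fin (m + 1) → ℝ) : 0 < ∑ s, x s ^ 2 + ε :=
    add_pos_of_nonneg_of_pos (Finset.sum_nonneg fun s _ ↦ sq_nonneg _) hε
  have h1 : ContDiff ℝ 1 fun x : Fin (m + 1) → ℝ ↦ √(∑ s, x s ^ 2 + ε) :=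
    ContDiff.sqrt (by fun_prop) fun x ↦ (hpos x).ne'
  exact ((h1.pow _).inv fun x ↦ (pow_pos (Real.sqrt_pos.2 (hpos x)) _).ne').mul (by fun_prop)

theorem fderiv_regKernel_symm {ε : ℝ} (hε : 0 < ε) (s t : Fin (m + 1)) (x : Fin (m + 1) → ℝ) :
    fderiv ℝ (regKernel ε t) x (Pi.single s 1) = fderiv ℝ (regKernel ε s) x (Pi.single t 1) := by
  have hpos : 0 < ∑ s, x s ^ 2 + ε :=
    add_pos_of_nonneg_of_pos (Finset.sum_nonneg fun s _ ↦ sq_nonneg _) hε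
  have hh : DifferentiableAt ℝ (fun u : ℝ ↦ (√(u + ε) ^ (m + 1))⁻¹) (∑ s, x s ^ 2) :=
    (((by fun_prop : DifferentiableAt ℝ (fun u : ℝ ↦ u + ε) (∑ s, x s ^ 2)).sqrt hpos.ne').pow _).inv
      (pow_pos (Real.sqrt_pos.2 hpos) _).ne'
  have hq : HasFDerivAt (fun x : Fin (m + 1) → ℝ ↦ ∑ s, x s ^ 2)
      (∑ s, (2 * x s) • ContinuousLinearMap.proj (R := ℝ) (φ := fun _ : Fin (m + 1) ↦ ℝ) s) x := by
    refine HasFDerivAt.fun_sum fun i _ ↦ ?_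
    simpa using (hasFDerivAt_apply (𝕜 := ℝ) i x).pow 2
  have key (t s : Fin (m + 1)) : fderiv ℝ (regKernel ε t) x (Pi.single s 1) =
      (√(∑ s, x s ^ 2 + ε) ^ (m + 1))⁻¹ * (Pi.single s 1 : Fin (m + 1) → ℝ) t +
        x t * (deriv (fun u : ℝ ↦ (√(u + ε) ^ (m + 1))⁻¹) (∑ s, x s ^ 2) * (2 * x s)) := by
    have := (hh.hasDerivAt.comp_hasFDerivAt x hq).mul (hasFDerivAt_apply (𝕜 := ℝ) t x)
    have e := this.fderiv
    rw [show fderiv ℝ (regKernel ε t) x = _ from e]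
    simp [Pi.single_apply]
  rw [key, key]
  simp only [Pi.single_apply, eq_comm (a := s)]
  ring

theorem integral_regKernel_smul_fderiv_symm {ε : ℝ} (hε : 0 < ε) (s t : Fin (m + 1))
    {φ : (Fin (m + 1) → ℝ) → F} (hφ : ContDiff ℝ 1 φ) (hφs : HasCompactSupport φ) :
    ∫ x, regKernel ε t x • fderiv ℝ φ x (Pi.single s 1) =
      ∫ x, regKernel ε s x • fderiv ℝ φ x (Pi.single t 1) := by
  have hc : Continuous (fderiv ℝ φ) := hφ.continuous_fderiv one_ne_zero
  have hcs : HasCompactSupport (fderiv ℝ φ) := hφs.fderiv ℝ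
  have key (t s : Fin (m + 1)) : ∫ x, regKernel ε t x • fderiv ℝ φ x (Pi.single s 1) =
      -∫ x, fderiv ℝ (regKernel ε t) x (Pi.single s 1) • φ x := by
    have hr := contDiff_regKernel hε t
    refine integral_smul_fderiv_eq_neg_fderiv_smul_of_integrable ?_ ?_ ?_
      (fun x _ ↦ hr.differentiable one_ne_zero x) (fun x _ ↦ hφ.differentiable one_ne_zero x)
    · exact (((hr.continuous_fderiv one_ne_zero).clm_apply continuous_const).smul
        hφ.continuous).integrable_of_hasCompactSupport hφs.smul_left
    · exact (hr.continuous.smul (hc.clm_apply continuous_const)).integrable_of_hasCompactSupport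
        (hcs.comp_left (g := fun L : (Fin (m + 1) → ℝ) →L[ℝ] F ↦ L (Pi.single s 1))
          (by simp)).smul_left
    · exact (hr.continuous.smul hφ.continuous).integrable_of_hasCompactSupport hφs.smul_left
  rw [key, key]
  simp only [fderiv_regKernel_symm hε s t]

theorem norm_regKernel_le {ε : ℝ} (hε : 0 < ε) (t : Fin (m + 1)) (x : Fin (m + 1) → ℝ) :
    ‖regKernel ε t x‖ ≤ ‖rieszKernel t x‖ := by
  rcases eq_or_ne (x t) 0 with h | h
  · simp [regKernel, rieszKernel, h]
  · have he : 0 < enormM x := (abs_pos.2 h).trans_le (abs_apply_le_enormM x t)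
    rw [regKernel, rieszKernel, norm_mul, norm_mul, norm_inv, norm_inv, norm_pow, norm_pow,
      Real.norm_of_nonneg (Real.sqrt_nonneg _), Real.norm_of_nonneg he.le]
    gcongr
    unfold enormM
    gcongr
    linarith

theorem tendsto_regKernel (t : Fin (m + 1)) (x : Fin (m + 1) → ℝ) :
    Tendsto (fun ε ↦ regKernel ε t x) (𝓝[>] 0) (𝓝 (rieszKernel t x)) := by
  rcases eq_or_ne (x t) 0 with h | h
  · simp [regKernel, rieszKernel, h]
  · have he : 0 < enormM x := (abs_pos.2 h).trans_le (abs_apply_le_enormM x t)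
    have h0 : regKernel 0 t x = rieszKernel t x := by simp [regKernel, rieszKernel, enormM]
    rw [← h0]
    refine (ContinuousAt.tendsto ?_).mono_left nhdsWithin_le_nhds
    unfold regKernel
    refine ContinuousAt.mul (ContinuousAt.inv₀ (by fun_prop) ?_) continuousAt_const
    rw [add_zero]
    exact (pow_pos he _).ne'

theorem integral_rieszKernel_smul_fderiv_symm (s t : Fin (m + 1))
    {φ : (Fin (m + 1) → ℝ) → F} (hφ : ContDiff ℝ 1 φ) (hφs : HasCompactSupport φ) :
    ∫ x, rieszKernel t x • fderiv ℝ φ x (Pi.single s 1) =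
      ∫ x, rieszKernel s x • fderiv ℝ φ x (Pi.single t 1) := by
  have hc : Continuous (fderiv ℝ φ) := hφ.continuous_fderiv one_ne_zero
  have hcs : HasCompactSupport (fderiv ℝ φ) := hφs.fderiv ℝ
  have key (t s : Fin (m + 1)) :
      Tendsto (fun ε ↦ ∫ x, regKernel ε t x • fderiv ℝ φ x (Pi.single s 1)) (𝓝[>] 0)
        (𝓝 (∫ x, rieszKernel t x • fderiv ℝ φ x (Pi.single s 1))) := by
    refine tendsto_integral_filter_of_dominated_convergence
      (fun x ↦ ‖rieszKernel t x • fderiv ℝ φ x (Pi.single s 1)‖) ?_ ?_ ?_ ?_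
    · filter_upwards [self_mem_nhdsWithin] with ε hε
      exact ((contDiff_regKernel hε t).continuous.smul
        (hc.clm_apply continuous_const)).aestronglyMeasurable
    · filter_upwards [self_mem_nhdsWithin] with ε hε
      refine .of_forall fun x ↦ ?_
      rw [norm_smul, norm_smul]
      gcongr
      exact norm_regKernel_le hε t x
    · exact (integrable_rieszKernel_smul t (hc.clm_apply continuous_const)
        (hcs.comp_left (g := fun L : (Fin (m + 1) → ℝ) →L[ℝ] F ↦ L (Pi.single s 1))
          (by simp))).norm
    · exact .of_forall fun x ↦ (tendsto_regKernel t x).smul_const _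
  refine tendsto_nhds_unique (key t s) ((key s t).congr' ?_)
  filter_upwards [self_mem_nhdsWithin] with ε hε
  exact (integral_regKernel_smul_fderiv_symm hε s t hφ hφs).symm

end Kernel

section Parameter

variable {P G : Type*} [NormedAddCommGroup P] [NormedSpace ℝ P]
  [NormedAddCommGroup G] [NormedSpace ℝ G]

theorem hasCompactSupport_comp_add {F : Type*} [Zero F] {ι : G →L[ℝ] P}
    (hι : IsClosedEmbedding ι) {f : P → F} (hfs : HasCompactSupport f) (x : P) :
    HasCompactSupport fun y ↦ f (x + ι y) :=
  hfs.comp_isClosedEmbedding ((Homeomorph.addLeft x).isClosedEmbedding.comp hι)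

variable {F : Type*} [NormedAddCommGroup F] [NormedSpace ℝ F]

theorem integrable_smul_comp_add [FiniteDimensional ℝ G] [MeasurableSpace G]
    [BorelSpace G] {μ : Measure G} {k : G → ℝ} (hk : LocallyIntegrable k μ) {ι : G →L[ℝ] P}
    (hι : IsClosedEmbedding ι) {f : P → F} (hf : Continuous f) (hfs : HasCompactSupport f)
    (x : P) : Integrable (fun y ↦ k y • f (x + ι y)) μ :=
  hk.integrable_smul_right_of_hasCompactSupport (by fun_prop)
    (hasCompactSupport_comp_add hι hfs x)

theorem hasFDerivAt_integral_smul_comp_add [FiniteDimensional ℝ G] [MeasurableSpace G]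
    [BorelSpace G] {μ : Measure G} {k : G → ℝ} (hk : LocallyIntegrable k μ) {ι : G →L[ℝ] P}
    (hι : Isometry ι) {g : P → F} (hg : ContDiff ℝ 1 g) (hgs : HasCompactSupport g) (x : P) :
    HasFDerivAt (fun x ↦ ∫ y, k y • g (x + ι y) ∂μ) (∫ y, k y • fderiv ℝ g (x + ι y) ∂μ) x := by
  have hc : Continuous (fderiv ℝ g) := hg.continuous_fderiv one_ne_zero
  have hcs : HasCompactSupport (fderiv ℝ g) := hgs.fderiv ℝ
  have hemb : IsClosedEmbedding ι := hι.isClosedEmbedding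
  obtain ⟨C, hC⟩ := hc.bounded_above_of_compact_support hcs
  obtain ⟨R, hR⟩ := hcs.isBounded.subset_closedBall 0
  set K : Set G := closedBall 0 (R + (‖x‖ + 1))
  refine hasFDerivAt_integral_of_dominated_of_fderiv_le (s := ball x 1)
    (F' := fun x y ↦ k y • fderiv ℝ g (x + ι y)) (bound := K.indicator fun y ↦ ‖k y‖ * C)
    (ball_mem_nhds x one_pos)
    (.of_forall fun z ↦ (integrable_smul_comp_add hk hemb hg.continuous hgs z).aestronglyMeasurable)
    (integrable_smul_comp_add hk hemb hg.continuous hgs x)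
    (integrable_smul_comp_add hk hemb hc hcs x).aestronglyMeasurable ?_ ?_ ?_
  · refine .of_forall fun y z hz ↦ ?_
    by_cases hy : y ∈ K
    · rw [indicator_of_mem hy, norm_smul]
      gcongr
      exact hC _
    · rw [indicator_of_notMem hy, norm_le_zero_iff,
        image_eq_zero_of_notMem_tsupport (f := fderiv ℝ g), smul_zero]
      intro hmem
      refine hy ?_
      have h1 : ‖z + ι y‖ ≤ R := by simpa using hR hmem
      have h2 : ‖ι y‖ = ‖y‖ := by simpa using hι.norm_map_of_map_zero (map_zero ι) y
      have h3 : ‖z‖ ≤ ‖x‖ + 1 := by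
        have := norm_le_norm_add_norm_sub' z x
        have h4 : ‖z - x‖ < 1 := by simpa [dist_eq_norm] using hz
        linarith
      have h5 : ‖ι y‖ ≤ ‖z + ι y‖ + ‖z‖ := by
        simpa using norm_sub_le (z + ι y) z
      simp only [K, mem_closedBall_zero_iff]
      linarith
  · rw [integrable_indicator_iff measurableSet_closedBall]
    exact (hk.integrableOn_isCompact (isCompact_closedBall _ _)).norm.mul_const C
  · refine .of_forall fun y z _ ↦ ?_
    have h1 := (hg.differentiable one_ne_zero (z + ι y)).hasFDerivAt
    exact (h1.comp z ((hasFDerivAt_id z).add_const (ι y))).const_smul (k y)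

end Parameter

section CauchyTransform

theorem update_add_eq_add_single (x : Mn n m) (i : Fin n) (y : Fin (m + 1) → ℝ) :
    Function.update x i (y + x i) = x + ContinuousLinearMap.single ℝ _ i y := by
  ext j s
  rcases eq_or_ne j i with rfl | h
  · simp [add_comm]
  · simp [h]

theorem isometry_single (i : Fin n) :
    Isometry (ContinuousLinearMap.single ℝ (fun _ : Fin n ↦ Fin (m + 1) → ℝ) i) :=
  AddMonoidHomClass.isometry_of_norm _ fun y ↦
    Pi.norm_single (G := fun _ : Fin n ↦ Fin (m + 1) → ℝ) (i := i) y

/-- Multiplication by the normalized conjugate basis element `v_t^c`, as a continuous map. -/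
def conjMul (H : HCAlg 𝔸 m) (t : Fin (m + 1)) : 𝔸 →L[ℝ] 𝔸 :=
  haveI := H.findim
  LinearMap.toContinuousLinearMap ((usigma (m + 1))⁻¹ • H.mul (H.conj (H.v t)))

theorem conjMul_apply (H : HCAlg 𝔸 m) (t : Fin (m + 1)) (a : 𝔸) :
    conjMul H t a = (usigma (m + 1))⁻¹ • H.mul (H.conj (H.v t)) a := rfl

/-- Left multiplication by `v_s`, as a continuous map. -/
def vMul (H : HCAlg 𝔸 m) (s : Fin (m + 1)) : 𝔸 →L[ℝ] 𝔸 :=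
  haveI := H.findim
  LinearMap.toContinuousLinearMap (H.mul (H.v s))

theorem vMul_apply (H : HCAlg 𝔸 m) (s : Fin (m + 1)) (a : 𝔸) :
    vMul H s a = H.mul (H.v s) a := rfl

theorem mul_CauchyE (H : HCAlg 𝔸 m) (y : Fin (m + 1) → ℝ) (a : 𝔸) :
    H.mul (CauchyE H y) a = ∑ t, conjMul H t (rieszKernel t y • a) := by
  simp only [CauchyE, embM, map_sum, map_smul, LinearMap.smul_apply, LinearMap.sum_apply,
    Finset.smul_sum, conjMul_apply, smul_smul, rieszKernel]
  refine Finset.sum_congr rfl fun t _ ↦ ?_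
  congr 1
  rw [mul_inv]
  ring

theorem integrable_mul_CauchyE (H : HCAlg 𝔸 m) {f : (Fin (m + 1) → ℝ) → 𝔸} (hf : Continuous f)
    (hfs : HasCompactSupport f) : Integrable fun y ↦ H.mul (CauchyE H y) (f y) := by
  simp only [mul_CauchyE]
  exact integrable_finsetSum _ fun t _ ↦
    (conjMul H t).integrable_comp (integrable_rieszKernel_smul t hf hfs)

theorem integral_mul_CauchyE (H : HCAlg 𝔸 m) {f : (Fin (m + 1) → ℝ) → 𝔸} (hf : Continuous f)
    (hfs : HasCompactSupport f) :
    ∫ y, H.mul (CauchyE H y) (f y) = ∑ t, conjMul H t (∫ y, rieszKernel t y • f y) := by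
  have := H.findim
  have := FiniteDimensional.complete ℝ 𝔸
  simp only [mul_CauchyE]
  have hi (t : Fin (m + 1)) := integrable_rieszKernel_smul t hf hfs
  rw [integral_finsetSum _ fun t _ ↦ (conjMul H t).integrable_comp (hi t)]
  exact Finset.sum_congr rfl fun t _ ↦ (conjMul H t).integral_comp_comm (hi t)

/-- The Cauchy transform inverts the Dirac operator (up to sign) on compactly supported
functions. -/
theorem sum_v_mul_integral_CauchyE_fderiv (H : HCAlg 𝔸 m) {φ : (Fin (m + 1) → ℝ) → 𝔸}
    (hφ : ContDiff ℝ 1 φ) (hφs : HasCompactSupport φ) :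
    ∑ s, H.mul (H.v s) (∫ y, H.mul (CauchyE H y) (fderiv ℝ φ y (Pi.single s 1))) = -φ 0 := by
  have := H.findim
  have := FiniteDimensional.complete ℝ 𝔸
  have hc : Continuous (fderiv ℝ φ) := hφ.continuous_fderiv one_ne_zero
  have hcs : HasCompactSupport (fderiv ℝ φ) := hφs.fderiv ℝ
  have h1 (s : Fin (m + 1)) := integral_mul_CauchyE H
    (f := fun y ↦ fderiv ℝ φ y (Pi.single s 1)) (hc.clm_apply continuous_const)
    (hcs.comp_left (g := fun L : (Fin (m + 1) → ℝ) →L[ℝ] 𝔸 ↦ L (Pi.single s 1)) (by simp))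
  simp only [h1, conjMul_apply, ← Finset.smul_sum, map_smul]
  simp only [map_sum]
  rw [H.sum_mul_v_mul_conj_v (fun t s ↦ ∫ y, rieszKernel t y • fderiv ℝ φ y (Pi.single s 1))
      fun s t ↦ integral_rieszKernel_smul_fderiv_symm t s hφ hφs,
    sum_integral_rieszKernel_smul_fderiv hφ hφs, smul_neg, smul_smul,
    inv_mul_cancel₀ usigma_pos.ne', one_smul]

variable {g : Mn n m → 𝔸}

theorem continuous_pd (hg : ContDiff ℝ 1 g) (j : Fin n) (s : Fin (m + 1)) :
    Continuous (pd g j s) :=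
  (hg.continuous_fderiv one_ne_zero).clm_apply continuous_const

theorem hasCompactSupport_pd (hgs : HasCompactSupport g) (j : Fin n) (s : Fin (m + 1)) :
    HasCompactSupport (pd g j s) :=
  (hgs.fderiv ℝ).comp_left (g := fun L : Mn n m →L[ℝ] 𝔸 ↦ L (Pi.single j (Pi.single s 1)))
    (by simp)

theorem continuous_comp_update {X : Type*} [TopologicalSpace X] {f : Mn n m → X}
    (hf : Continuous f) (i : Fin n) (x : Mn n m) :
    Continuous fun y ↦ f (Function.update x i (y + x i)) := by
  simp only [update_add_eq_add_single]
  fun_prop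

theorem hasCompactSupport_comp_update {X : Type*} [Zero X] {f : Mn n m → X}
    (hfs : HasCompactSupport f) (i : Fin n) (x : Mn n m) :
    HasCompactSupport fun y ↦ f (Function.update x i (y + x i)) := by
  simp only [update_add_eq_add_single]
  exact hasCompactSupport_comp_add (isometry_single i).isClosedEmbedding hfs x

theorem pd_Fint (H : HCAlg 𝔸 m) (hn : 0 < n) (hg : ContDiff ℝ 1 g) (hgs : HasCompactSupport g)
    (j : Fin n) (s : Fin (m + 1)) (x : Mn n m) :
    pd (Fint H hn g) j s x = ∫ y1, H.mul (CauchyE H y1)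
      (pd g j s (Function.update x ⟨0, hn⟩ (y1 + x ⟨0, hn⟩))) := by
  have hF : Fint H hn g = fun x ↦ ∑ t, conjMul H t
      (∫ y, rieszKernel t y • g (x + ContinuousLinearMap.single ℝ _ ⟨0, hn⟩ y)) := by
    funext x
    rw [Fint, integral_mul_CauchyE H (continuous_comp_update hg.continuous _ x)
      (hasCompactSupport_comp_update hgs _ x)]
    simp only [update_add_eq_add_single]
  have hc : Continuous (fderiv ℝ g) := hg.continuous_fderiv one_ne_zero
  have hcs : HasCompactSupport (fderiv ℝ g) := hgs.fderiv ℝ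
  have hd := HasFDerivAt.fun_sum (u := Finset.univ) fun t _ ↦
    (conjMul H t).hasFDerivAt.comp x (hasFDerivAt_integral_smul_comp_add
      (locallyIntegrable_rieszKernel t) (isometry_single ⟨0, hn⟩) hg hgs x)
  rw [integral_mul_CauchyE H (continuous_comp_update (continuous_pd hg j s) _ x)
    (hasCompactSupport_comp_update (hasCompactSupport_pd hgs j s) _ x), pd, hF]
  simp only [Function.comp_apply] at hd
  rw [hd.fderiv, _root_.sum_apply]
  refine Finset.sum_congr rfl fun t _ ↦ ?_
  rw [ContinuousLinearMap.comp_apply, ContinuousLinearMap.integral_apply]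
  · simp only [update_add_eq_add_single]
    rfl
  · exact integrable_rieszKernel_smul t (by fun_prop)
      (hasCompactSupport_comp_add (isometry_single _).isClosedEmbedding hcs x)

theorem sum_v_mul_integral_CauchyE_pd (H : HCAlg 𝔸 m) (hg : ContDiff ℝ 1 g)
    (hgs : HasCompactSupport g) (i : Fin n) (x : Mn n m) :
    ∑ s, H.mul (H.v s) (∫ y1, H.mul (CauchyE H y1)
      (pd g i s (Function.update x i (y1 + x i)))) = -g x := by
  set ι := ContinuousLinearMap.single ℝ (fun _ : Fin n ↦ Fin (m + 1) → ℝ) i with hι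
  have hφ : ContDiff ℝ 1 fun y ↦ g (x + ι y) := hg.comp (by fun_prop)
  have h := sum_v_mul_integral_CauchyE_fderiv H hφ
    (hasCompactSupport_comp_add (isometry_single i).isClosedEmbedding hgs x)
  have hfd (y : Fin (m + 1) → ℝ) (s : Fin (m + 1)) :
      fderiv ℝ (fun y ↦ g (x + ι y)) y (Pi.single s 1) =
        pd g i s (Function.update x i (y + x i)) := by
    have h1 : HasFDerivAt (fun y ↦ g (x + ι y)) ((fderiv ℝ g (x + ι y)).comp ι) y :=
      (hg.differentiable one_ne_zero (x + ι y)).hasFDerivAt.comp y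
        (ι.hasFDerivAt.const_add x)
    rw [h1.fderiv, update_add_eq_add_single]
    rfl
  simpa only [hfd, map_zero, add_zero] using h

end CauchyTransform

/-- (Remark 5.1): condition (ii) of Theorem 5.2, namely
`g_j(x) = −∂̄_j (∫_M E(y₁) g₁(y₁ + x₁, x⁰) dV(y₁))` for `j = 2, …, n`,
is equivalent to
`∫_M ∑_s v_s (E(y₁) ((∂g_j/∂x_{1,s} − ∂g₁/∂x_{j,s})(y₁ + x₁, x⁰))) dV(y₁) = 0`
for `j = 2, …, n`. -/
theorem condition_ii_equiv_remark_form (H : HCAlg 𝔸 m) (hn : 1 < n) (k : ℕ) (hk : 3 ≤ k)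
    (g : Fin n → Mn n m → 𝔸)
    (hg : ∀ j, ContDiff ℝ k (g j)) (hgs : ∀ j, HasCompactSupport (g j)) :
    (∀ j : Fin n, j ≠ ⟨0, by omega⟩ → ∀ x : Mn n m,
        g j x = - dbar H (Fint H (by omega) (g ⟨0, by omega⟩)) j x) ↔
    (∀ j : Fin n, j ≠ ⟨0, by omega⟩ → ∀ x : Mn n m,
        (∫ y1 : Fin (m + 1) → ℝ, ∑ s, H.mul (H.v s)
          (H.mul (CauchyE H y1)
            (pd (g j) ⟨0, by omega⟩ s
                (Function.update x ⟨0, by omega⟩ (y1 + x ⟨0, by omega⟩)) -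
              pd (g ⟨0, by omega⟩) j s
                (Function.update x ⟨0, by omega⟩ (y1 + x ⟨0, by omega⟩))))) = 0) := by
  have h1 (i : Fin n) : ContDiff ℝ 1 (g i) := (hg i).of_le (by exact_mod_cast (by omega : 1 ≤ k))
  refine forall_congr' fun j ↦ imp_congr_right fun _ ↦ forall_congr' fun x ↦ ?_
  have hi (i l : Fin n) (s : Fin (m + 1)) := integrable_mul_CauchyE H
    (continuous_comp_update (continuous_pd (h1 i) l s) ⟨0, by omega⟩ x)
    (hasCompactSupport_comp_update (hasCompactSupport_pd (hgs i) l s) ⟨0, by omega⟩ x)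
  have := H.findim
  have := FiniteDimensional.complete ℝ 𝔸
  have hsub (s : Fin (m + 1)) : Integrable fun y1 : Fin (m + 1) → ℝ ↦
      H.mul (CauchyE H y1) (pd (g j) ⟨0, by omega⟩ s
          (Function.update x ⟨0, by omega⟩ (y1 + x ⟨0, by omega⟩))) -
        H.mul (CauchyE H y1) (pd (g ⟨0, by omega⟩) j s
          (Function.update x ⟨0, by omega⟩ (y1 + x ⟨0, by omega⟩))) :=
    (hi j _ s).sub (hi _ j s)
  have key : (∫ y1 : Fin (m + 1) → ℝ, ∑ s, H.mul (H.v s)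
      (H.mul (CauchyE H y1)
        (pd (g j) ⟨0, by omega⟩ s
            (Function.update x ⟨0, by omega⟩ (y1 + x ⟨0, by omega⟩)) -
          pd (g ⟨0, by omega⟩) j s
            (Function.update x ⟨0, by omega⟩ (y1 + x ⟨0, by omega⟩))))) =
      -g j x - dbar H (Fint H (by omega) (g ⟨0, by omega⟩)) j x := by
    simp only [map_sub (H.mul (CauchyE H _)), ← vMul_apply]
    rw [integral_finsetSum _ fun s _ ↦ (vMul H s).integrable_comp (hsub s),
      ← sum_v_mul_integral_CauchyE_pd H (h1 j) (hgs j) ⟨0, by omega⟩ x, dbar,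
      ← Finset.sum_sub_distrib]
    refine Finset.sum_congr rfl fun s _ ↦ ?_
    rw [(vMul H s).integral_comp_comm (hsub s), integral_sub (hi j _ s) (hi _ j s), map_sub,
      pd_Fint H _ (h1 _) (hgs _)]
    rfl
  rw [key, sub_eq_zero]
  exact ⟨fun h ↦ by rw [h, neg_neg], fun h ↦ by rw [← h, neg_neg]⟩

end
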